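/- Let H₀ be an n×n complex diagonal matrix with trace 0, H an n×n real diagonal matrix with pairwise distinct diagonal entries, O(H₀) = {g H₀ g⁻¹ : g ∈ GL(n,ℂ)}, S(H₀) the set of diagonal matrices in O(H₀), and for ε > 0 let O_ε = {x ∈ O(H₀) : ‖x − y‖ > ε for all y ∈ S(H₀)}. Define Z(x) = ‖⁅x,H⁆‖⁻² · ⁅x, ⁅xᴴ, H⁆⁆. Then for every ε > 0 there exists M_ε > 0 such that ‖Z(x)‖ ≤ M_ε for all x ∈ O_ε (in particular ⁅x,H⁆ ≠ 0 for such x, so Z(x) is defined). -/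

import Mathlib

open Matrix

attribute [local instance] Matrix.frobeniusNormedAddCommGroup Matrix.frobeniusNormedSpace

/-- The adjoint orbit of the diagonal matrix `H₀ = diagonal d`. -/
def adjointOrbit (n : ℕ) (d : Fin n → ℂ) : Set (Matrix (Fin n) (Fin n) ℂ) :=
  {x | ∃ g : GL (Fin n) ℂ, x = (g : Matrix (Fin n) (Fin n) ℂ) * Matrix.diagonal d *
        ((g⁻¹ : GL (Fin n) ℂ) : Matrix (Fin n) (Fin n) ℂ)}

/-- The real diagonal matrix `H`, viewed as a complex matrix. -/
noncomputable def Hmat (n : ℕ) (h : Fin n → ℝ) : Matrix (Fin n) (Fin n) ℂ :=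
  Matrix.diagonal (fun i => (h i : ℂ))

/-- The transversal vector field `Z(x) = ‖⁅x,H⁆‖⁻² • ⁅x, ⁅xᴴ, H⁆⁆`. -/
noncomputable def Zfield (n : ℕ) (h : Fin n → ℝ) :
    Matrix (Fin n) (Fin n) ℂ → Matrix (Fin n) (Fin n) ℂ :=
  fun x => (‖⁅x, Hmat n h⁆‖ ^ 2)⁻¹ • ⁅x, ⁅xᴴ, Hmat n h⁆⁆

lemma isDiag_of_lie_Hmat_eq_zero {n : ℕ} {h : Fin n → ℝ} (hreg : Function.Injective h)
    {x : Matrix (Fin n) (Fin n) ℂ} (hx : ⁅x, Hmat n h⁆ = 0) : x.IsDiag := by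
  intro i j hij
  have hentry := congrFun (congrFun hx i) j
  simp only [Ring.lie_def, Hmat, Matrix.sub_apply, mul_diagonal, diagonal_mul,
    Matrix.zero_apply] at hentry
  have hne : (h j : ℂ) - h i ≠ 0 := by
    rw [sub_ne_zero]
    exact_mod_cast fun e => hij (hreg e).symm
  have hprod : x i j * ((h j : ℂ) - h i) = 0 := by linear_combination hentry
  exact (mul_eq_zero.mp hprod).resolve_right hne

lemma norm_lie_conjTranspose_Hmat (n : ℕ) (h : Fin n → ℝ) (x : Matrix (Fin n) (Fin n) ℂ) :
    ‖⁅xᴴ, Hmat n h⁆‖ = ‖⁅x, Hmat n h⁆‖ := by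
  have hH : (Hmat n h)ᴴ = Hmat n h := by
    simp only [Hmat, diagonal_conjTranspose]
    congr 1
    ext i
    simp
  rw [← frobenius_norm_conjTranspose ⁅x, Hmat n h⁆, ← norm_neg]
  congr 1
  simp [Ring.lie_def, hH]

lemma norm_lie_le {n : ℕ} (x y : Matrix (Fin n) (Fin n) ℂ) : ‖⁅x, y⁆‖ ≤ 2 * ‖x‖ * ‖y‖ := by
  rw [Ring.lie_def]
  linarith [norm_sub_le (x * y) (y * x), frobenius_norm_mul x y, frobenius_norm_mul y x]

lemma norm_Zfield_le (n : ℕ) (h : Fin n → ℝ) (x : Matrix (Fin n) (Fin n) ℂ)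
    (hx : ⁅x, Hmat n h⁆ ≠ 0) : ‖Zfield n h x‖ ≤ 2 * ‖x‖ / ‖⁅x, Hmat n h⁆‖ := by
  have hpos : 0 < ‖⁅x, Hmat n h⁆‖ := norm_pos_iff.mpr hx
  have hle := norm_lie_le x ⁅xᴴ, Hmat n h⁆
  rw [norm_lie_conjTranspose_Hmat] at hle
  rw [Zfield, norm_smul, norm_inv, norm_pow, norm_norm, inv_mul_le_iff₀ (by positivity)]
  refine hle.trans_eq ?_
  field_simp

lemma continuous_norm_lie_Hmat (n : ℕ) (h : Fin n → ℝ) :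
    Continuous fun x : Matrix (Fin n) (Fin n) ℂ => ‖⁅x, Hmat n h⁆‖ := by
  simp only [Ring.lie_def]
  exact continuous_norm.comp (by fun_prop)

lemma det_scalar_sub_of_mem_adjointOrbit {n : ℕ} {d : Fin n → ℂ}
    {x : Matrix (Fin n) (Fin n) ℂ} (hx : x ∈ adjointOrbit n d) (t : ℂ) :
    (t • (1 : Matrix (Fin n) (Fin n) ℂ) - x).det = ∏ i, (t - d i) := by
  obtain ⟨g, rfl⟩ := hx
  have hconj : t • (1 : Matrix (Fin n) (Fin n) ℂ) - g.1 * diagonal d * (g⁻¹).1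
      = g.1 * diagonal (fun i => t - d i) * (g⁻¹).1 := by
    have hdiag : diagonal (fun i => t - d i) = t • (1 : Matrix (Fin n) (Fin n) ℂ) - diagonal d := by
      rw [smul_one_eq_diagonal, diagonal_sub]
    have hg : g.1 * (g⁻¹).1 = 1 := by simp
    rw [hdiag, mul_sub, sub_mul, mul_smul_comm, mul_one, smul_mul_assoc, hg]
  rw [hconj, det_mul_right_comm, ← det_diagonal]
  simp

lemma diagonal_comp_perm_mem_adjointOrbit {n : ℕ} (d : Fin n → ℂ) (σ : Equiv.Perm (Fin n)) :
    diagonal (d ∘ σ) ∈ adjointOrbit n d := by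
  have hinv : σ.permMatrix ℂ * σ⁻¹.permMatrix ℂ = 1 := by
    rw [← permMatrix_mul, inv_mul_cancel, permMatrix_one]
  have hinv' : σ⁻¹.permMatrix ℂ * σ.permMatrix ℂ = 1 := by
    rw [← permMatrix_mul, mul_inv_cancel, permMatrix_one]
  refine ⟨⟨σ.permMatrix ℂ, σ⁻¹.permMatrix ℂ, hinv, hinv'⟩, ?_⟩
  have hcomm : σ.permMatrix ℂ * diagonal d = diagonal (d ∘ σ) * σ.permMatrix ℂ := by
    ext i j
    simp only [mul_diagonal, diagonal_mul, Equiv.Perm.permMatrix, PEquiv.toMatrix_apply,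
      Equiv.toPEquiv_apply, Option.mem_some_iff, Function.comp_apply]
    split_ifs with hij
    · rw [hij, mul_comm]
    · simp
  change _ = σ.permMatrix ℂ * diagonal d * σ⁻¹.permMatrix ℂ
  rw [hcomm, mul_assoc, hinv, mul_one]

/-- Two families of scalars over a finite type with the same multiset of values differ by a
permutation of the index type. -/
lemma exists_perm_comp_eq_of_map_univ_eq {ι α : Type*} [Fintype ι] {f g : ι → α}
    (hfg : Finset.univ.val.map f = Finset.univ.val.map g) :
    ∃ σ : Equiv.Perm ι, g ∘ σ = f := by
  classical
  have hcard : ∀ a, Nonempty ({i // f i = a} ≃ {i // g i = a}) := fun a => by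
    refine Fintype.card_eq.mp ?_
    have hcount := congrArg (Multiset.count a) hfg
    rw [Multiset.count_map, Multiset.count_map] at hcount
    simpa only [Fintype.card_subtype, Finset.card_def, Finset.filter_val, eq_comm] using hcount
  exact ⟨Equiv.ofFiberEquiv fun a => (hcard a).some,
    funext fun i => Equiv.ofFiberEquiv_map _ i⟩

lemma mem_adjointOrbit_of_isDiag {n : ℕ} {d : Fin n → ℂ} {x : Matrix (Fin n) (Fin n) ℂ}
    (hdiag : x.IsDiag)
    (hdet : ∀ t : ℂ, (t • (1 : Matrix (Fin n) (Fin n) ℂ) - x).det = ∏ i, (t - d i)) :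
    x ∈ adjointOrbit n d := by
  have hpoly : ∏ i, (Polynomial.X - Polynomial.C (x i i))
      = ∏ i, (Polynomial.X - Polynomial.C (d i)) := by
    refine Polynomial.funext fun t => ?_
    rw [Polynomial.eval_prod, Polynomial.eval_prod]
    simp only [Polynomial.eval_sub, Polynomial.eval_X, Polynomial.eval_C]
    rw [← hdet t, ← hdiag.diagonal_diag, smul_one_eq_diagonal, diagonal_sub, det_diagonal]
    simp
  have hroots := congrArg Polynomial.roots hpoly
  have hroots_prod : ∀ a : Fin n → ℂ,
      (∏ i, (Polynomial.X - Polynomial.C (a i))).roots = Finset.univ.val.map a := fun a => by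
    rw [← Polynomial.roots_multiset_prod_X_sub_C (Finset.univ.val.map a), Multiset.map_map]
    rfl
  rw [hroots_prod, hroots_prod] at hroots
  obtain ⟨σ, hσ⟩ := exists_perm_comp_eq_of_map_univ_eq hroots
  have hx : diagonal (d ∘ σ) = x := by
    rw [hσ]
    exact hdiag.diagonal_diag
  exact hx ▸ diagonal_comp_perm_mem_adjointOrbit d σ

lemma eq_zero_of_isDiag_of_det {n : ℕ} {x : Matrix (Fin n) (Fin n) ℂ} (hdiag : x.IsDiag)
    (hdet : ∀ t : ℂ, (t • (1 : Matrix (Fin n) (Fin n) ℂ) - x).det = t ^ n) : x = 0 := by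
  rw [← hdiag.diagonal_diag]
  ext i j
  have hprod := hdet (x i i)
  rw [← hdiag.diagonal_diag, smul_one_eq_diagonal, diagonal_sub, det_diagonal,
    Finset.prod_eq_zero (Finset.mem_univ i) (by simp)] at hprod
  have hzero : x i i = 0 := by
    simpa using eq_zero_of_pow_eq_zero hprod.symm
  by_cases hij : i = j
  · subst hij; simpa using hzero
  · simp [hij]

/-- Unit matrices whose eigenvalues are `s • d` with `0 ≤ s ≤ 1` cannot have both `s` and their
commutator with `H` arbitrarily small. -/
lemma exists_le_norm_lie_Hmat_add {n : ℕ} (d : Fin n → ℂ) {h : Fin n → ℝ}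
    (hreg : Function.Injective h) :
    ∃ c > (0 : ℝ), ∀ (x : Matrix (Fin n) (Fin n) ℂ) (s : ℝ), ‖x‖ = 1 → 0 ≤ s → s ≤ 1 →
      (∀ t : ℂ, (t • (1 : Matrix (Fin n) (Fin n) ℂ) - x).det = ∏ i, (t - s * d i)) →
      c ≤ ‖⁅x, Hmat n h⁆‖ + s := by
  have : ProperSpace (Matrix (Fin n) (Fin n) ℂ) := FiniteDimensional.proper ℂ _
  let S : Set (Matrix (Fin n) (Fin n) ℂ × ℝ) :=
    (Metric.sphere 0 1 ×ˢ Set.Icc 0 1) ∩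
      {p | ∀ t : ℂ, (t • (1 : Matrix (Fin n) (Fin n) ℂ) - p.1).det = ∏ i, (t - p.2 * d i)}
  have hS : IsCompact S := by
    refine ((isCompact_sphere _ _).prod isCompact_Icc).inter_right ?_
    rw [Set.ofPred_forall]
    refine isClosed_iInter fun t => isClosed_eq ?_ ?_
    · exact Continuous.matrix_det (by fun_prop)
    · fun_prop
  have hcont : Continuous fun p : Matrix (Fin n) (Fin n) ℂ × ℝ => ‖⁅p.1, Hmat n h⁆‖ + p.2 :=
    ((continuous_norm_lie_Hmat n h).comp continuous_fst).add continuous_snd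
  have hpos : ∀ p ∈ S, 0 < ‖⁅p.1, Hmat n h⁆‖ + p.2 := by
    rintro ⟨x, s⟩ ⟨⟨hx, hs, -⟩, hdet⟩
    change 0 ≤ s at hs
    change 0 < ‖⁅x, Hmat n h⁆‖ + s
    replace hx : ‖x‖ = 1 := mem_sphere_zero_iff_norm.mp hx
    replace hdet : ∀ t : ℂ, (t • (1 : Matrix (Fin n) (Fin n) ℂ) - x).det
      = ∏ i, (t - s * d i) := hdet
    by_contra! hle
    have hnn := norm_nonneg ⁅x, Hmat n h⁆
    obtain rfl : s = 0 := by linarith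
    have hlie : ⁅x, Hmat n h⁆ = 0 := norm_le_zero_iff.mp (by linarith)
    have hx0 := eq_zero_of_isDiag_of_det (isDiag_of_lie_Hmat_eq_zero hreg hlie)
      fun t => by simpa using hdet t
    rw [hx0, norm_zero] at hx
    exact zero_ne_one hx
  obtain ⟨c, hc, hcS⟩ := hS.exists_forall_le' hcont.continuousOn hpos
  exact ⟨c, hc, fun x s hx hs0 hs1 hdet =>
    hcS (x, s) ⟨⟨mem_sphere_zero_iff_norm.mpr hx, hs0, hs1⟩, hdet⟩⟩

/-- A matrix of the orbit is controlled by its commutator with `H`, up to an additive constant. -/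
lemma exists_norm_le_of_mem_adjointOrbit {n : ℕ} (d : Fin n → ℂ) {h : Fin n → ℝ}
    (hreg : Function.Injective h) :
    ∃ K > (0 : ℝ), ∀ x ∈ adjointOrbit n d, ‖x‖ ≤ K * (‖⁅x, Hmat n h⁆‖ + 1) := by
  obtain ⟨c, hc, hcS⟩ := exists_le_norm_lie_Hmat_add d hreg
  refine ⟨max 1 c⁻¹, by positivity, fun x hx => ?_⟩
  have hnn := norm_nonneg ⁅x, Hmat n h⁆
  rcases le_total ‖x‖ 1 with h1 | h1
  · exact h1.trans (one_le_mul_of_one_le_of_one_le (le_max_left _ _) (by linarith))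
  · have hpos : 0 < ‖x‖ := by linarith
    have hle : c ≤ ‖⁅(‖x‖⁻¹ : ℂ) • x, Hmat n h⁆‖ + ‖x‖⁻¹ := by
      refine hcS _ _ ?_ (by positivity) (inv_le_one_of_one_le₀ h1) fun t => ?_
      · simp [norm_smul, hpos.ne']
      · have hne : (‖x‖ : ℂ) ≠ 0 := by exact_mod_cast hpos.ne'
        have hfac : t • (1 : Matrix (Fin n) (Fin n) ℂ) - (‖x‖⁻¹ : ℂ) • x
            = (‖x‖⁻¹ : ℂ) • ((‖x‖ * t) • (1 : Matrix (Fin n) (Fin n) ℂ) - x) := by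
          rw [smul_sub, smul_smul, inv_mul_cancel_left₀ hne]
        rw [hfac, det_smul, det_scalar_sub_of_mem_adjointOrbit hx, ← Finset.card_univ,
          ← Finset.prod_const, ← Finset.prod_mul_distrib]
        refine Finset.prod_congr rfl fun i _ => ?_
        push_cast
        field_simp
    rw [Ring.lie_def, smul_mul_assoc, mul_smul_comm, ← smul_sub, ← Ring.lie_def, norm_smul] at hle
    have hle' : c * ‖x‖ ≤ ‖⁅x, Hmat n h⁆‖ + 1 := by
      have := mul_le_mul_of_nonneg_right hle hpos.le
      simp only [norm_inv, Complex.norm_real, norm_norm] at this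
      rw [add_mul, inv_mul_cancel₀ hpos.ne', mul_right_comm, inv_mul_cancel₀ hpos.ne',
        one_mul] at this
      exact this
    calc ‖x‖ = c⁻¹ * (c * ‖x‖) := by field_simp
      _ ≤ c⁻¹ * (‖⁅x, Hmat n h⁆‖ + 1) := by gcongr
      _ ≤ _ := by gcongr; exact le_max_right _ _

/-- Away from the diagonal matrices of the orbit, the commutator with `H` is bounded below. -/
lemma exists_le_norm_lie_Hmat {n : ℕ} (d : Fin n → ℂ) {h : Fin n → ℝ}
    (hreg : Function.Injective h) {ε : ℝ} (hε : 0 < ε) :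
    ∃ c > (0 : ℝ), ∀ x ∈ adjointOrbit n d,
      (∀ y ∈ adjointOrbit n d, y.IsDiag → ε < ‖x - y‖) → c ≤ ‖⁅x, Hmat n h⁆‖ := by
  have : ProperSpace (Matrix (Fin n) (Fin n) ℂ) := FiniteDimensional.proper ℂ _
  obtain ⟨K, hK, hKx⟩ := exists_norm_le_of_mem_adjointOrbit d hreg
  let S : Set (Matrix (Fin n) (Fin n) ℂ) :=
    Metric.closedBall 0 (K * 2) ∩
      ({x | ∀ t : ℂ, (t • (1 : Matrix (Fin n) (Fin n) ℂ) - x).det = ∏ i, (t - d i)} ∩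
        {x | ∀ y ∈ adjointOrbit n d, y.IsDiag → ε ≤ ‖x - y‖})
  have hS : IsCompact S := by
    refine (isCompact_closedBall _ _).inter_right (IsClosed.inter ?_ ?_)
    · rw [Set.ofPred_forall]
      refine isClosed_iInter fun t => isClosed_eq ?_ continuous_const
      exact Continuous.matrix_det (by fun_prop)
    · simp only [Set.ofPred_forall]
      refine isClosed_iInter fun y => isClosed_iInter fun _ => isClosed_iInter fun _ => ?_
      exact isClosed_le continuous_const (continuous_id.sub continuous_const).norm
  obtain ⟨c, hc, hcS⟩ := hS.exists_forall_le' (a := 0)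
    (continuous_norm_lie_Hmat n h).continuousOn (by
      rintro x ⟨-, hdet, hfar⟩
      refine norm_pos_iff.mpr fun hlie => ?_
      have hdiag := isDiag_of_lie_Hmat_eq_zero hreg hlie
      have := hfar x (mem_adjointOrbit_of_isDiag hdiag hdet) hdiag
      rw [sub_self, norm_zero] at this
      linarith)
  refine ⟨min 1 c, by positivity, fun x hx hfar => ?_⟩
  rcases le_total ‖⁅x, Hmat n h⁆‖ 1 with h1 | h1
  · refine (min_le_right _ _).trans (hcS x ⟨?_, det_scalar_sub_of_mem_adjointOrbit hx,
      fun y hy hyd => (hfar y hy hyd).le⟩)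
    rw [mem_closedBall_zero_iff]
    exact (hKx x hx).trans (by gcongr; linarith)
  · exact (min_le_left _ _).trans h1

/-- Let `H₀ = diagonal d` be a traceless complex diagonal matrix and `H = diagonal h`
a regular real diagonal matrix (pairwise distinct entries).  For every `ε > 0` the
vector field `Z` is defined and bounded on the set `O_ε` of points of the adjoint orbit
`O(H₀)` at distance greater than `ε` from every diagonal matrix of the orbit. -/
theorem Zfield_bounded_on_O_eps
    (n : ℕ) (d : Fin n → ℂ) (htr : Matrix.trace (Matrix.diagonal d) = 0)
    (h : Fin n → ℝ) (hreg : Function.Injective h) :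
    ∀ ε > (0 : ℝ), ∃ M > (0 : ℝ), ∀ x ∈ adjointOrbit n d,
      (∀ y ∈ adjointOrbit n d, y.IsDiag → ε < ‖x - y‖) →
      ⁅x, Hmat n h⁆ ≠ 0 ∧ ‖Zfield n h x‖ ≤ M := by
  intro ε hε
  obtain ⟨K, hK, hKx⟩ := exists_norm_le_of_mem_adjointOrbit d hreg
  obtain ⟨c, hc, hcx⟩ := exists_le_norm_lie_Hmat d hreg hε
  refine ⟨2 * K * (1 + c⁻¹), by positivity, fun x hx hfar => ?_⟩
  have hle := hcx x hx hfar
  have hpos : 0 < ‖⁅x, Hmat n h⁆‖ := hc.trans_le hle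
  have hne : ⁅x, Hmat n h⁆ ≠ 0 := norm_pos_iff.mp hpos
  refine ⟨hne, (norm_Zfield_le n h x hne).trans ?_⟩
  rw [div_le_iff₀ hpos]
  have hone : 1 ≤ c⁻¹ * ‖⁅x, Hmat n h⁆‖ := by
    rw [← div_eq_inv_mul]
    exact (one_le_div hc).mpr hle
  calc 2 * ‖x‖ ≤ 2 * (K * (‖⁅x, Hmat n h⁆‖ + 1)) := by gcongr; exact hKx x hx
    _ ≤ 2 * (K * (‖⁅x, Hmat n h⁆‖ + c⁻¹ * ‖⁅x, Hmat n h⁆‖)) := by gcongr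
    _ = _ := by ring
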